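/- arXiv:cs/0508025 — 6 statements merged into one kernel-verified Lean document; each statement's English description precedes it below -/
import Mathlib

section
/- For every fixed integer M ≥ 1 and every real δ > 0 there exists T₀ such that for all integers T ≥ T₀ the following holds: with code length n = ⌈(1+δ)·e·(ln 2)·(M+1)²·log₂ T⌉ there exists a binary code C : Fin T → (Fin n → Bool) that is Zero False Drop of order M, i.e., for every subset S ⊆ Fin T with |S| ≤ M and every index i ∉ S, the codeword C i is not covered by the componentwise Boolean OR of the codewords {C j : j ∈ S}. -/
/-- A code `C` of `T` codewords of length `n` is Zero False Drop of order `M` if for every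
set `S` of at most `M` users and every user `i ∉ S`, the codeword `C i` is not covered by
the componentwise Boolean OR of the codewords of the users in `S`. -/
def IsZFD {T n : ℕ} (M : ℕ) (C : Fin T → Fin n → Bool) : Prop :=
  ∀ S : Finset (Fin T), S.card ≤ M → ∀ i : Fin T, i ∉ S →
    ¬ (∀ ℓ : Fin n, C i ℓ = true → ∃ j ∈ S, C j ℓ = true)

open Finset in
/-- The number of columns over an alphabet of size `M + 1` that have the letter `0` at `i` and a
nonzero letter at each of `M` given places, as a proportion of all columns. -/
lemma card_separating_columns {T M : ℕ} {S : Finset (Fin T)} (hS : #S = M) {i : Fin T}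
    (hi : i ∉ S) :
    (#{g : Fin T → Fin (M + 1) | g i = 0 ∧ ∀ j ∈ S, g j ≠ 0} : ℝ) =
      (M : ℝ) ^ M / (M + 1) ^ (M + 1) * (M + 1) ^ T := by
  have hpi : ({g : Fin T → Fin (M + 1) | g i = 0 ∧ ∀ j ∈ S, g j ≠ 0} : Finset _) =
      Fintype.piFinset fun j ↦ if j = i then {0} else if j ∈ S then univ.erase 0 else univ := by
    ext g
    simp only [mem_filter, mem_univ, true_and, Fintype.mem_piFinset]
    constructor
    · rintro ⟨h0, hg⟩ j
      split_ifs with hji hj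
      · simp [hji, h0]
      · simp [hg j hj]
      · simp
    · intro hg
      refine ⟨by simpa using hg i, fun j hj ↦ ?_⟩
      have hji : j ≠ i := fun h ↦ hi (h ▸ hj)
      simpa [hji, hj] using hg j
  have hweight : ∀ j : Fin T,
      (#(if j = i then {0} else if j ∈ S then univ.erase 0 else univ : Finset (Fin (M + 1))) : ℝ)
        = (if j = i then 1 / ((M : ℝ) + 1) else 1) * (if j ∈ S then (M : ℝ) / (M + 1) else 1)
          * (M + 1) := by
    intro j
    have hM : (M : ℝ) + 1 ≠ 0 := by positivity
    by_cases hji : j = i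
    · subst hji
      simp [hi, hM]
    · by_cases hj : j ∈ S
      · simp [hji, hj, hM]
      · simp [hji, hj]
  rw [hpi, Fintype.card_piFinset]
  push_cast
  rw [prod_congr rfl fun j _ ↦ hweight j, prod_mul_distrib, prod_mul_distrib, prod_ite_eq',
    prod_ite_mem]
  simp [hS]
  left
  field_simp
  ring

lemma pow_div_succ_pow_succ_le_one (M : ℕ) : (M : ℝ) ^ M / (M + 1) ^ (M + 1) ≤ 1 := by
  rw [div_le_one (by positivity)]
  calc (M : ℝ) ^ M ≤ (M + 1) ^ M := by gcongr; linarith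
    _ ≤ (M + 1) ^ (M + 1) :=
      pow_le_pow_right₀ (by linarith [Nat.cast_nonneg (α := ℝ) M]) (Nat.le_succ M)

open Finset in
/-- Counting form of the union bound over all pairs of a user and a set of `M` other users. -/
lemma exists_isZFD_of_union_bound {T M n : ℕ} (hT : M + 1 ≤ T)
    (h : (T : ℝ) ^ (M + 1) * (1 - (M : ℝ) ^ M / (M + 1) ^ (M + 1)) ^ n < 1) :
    ∃ C : Fin T → Fin n → Bool, IsZFD M C := by
  classical
  let separating (x : Fin T × Finset (Fin T)) : Finset (Fin T → Fin (M + 1)) :=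
    {g | g x.1 = 0 ∧ ∀ j ∈ x.2, g j ≠ 0}
  let pairs : Finset (Fin T × Finset (Fin T)) :=
    {x ∈ univ ×ˢ powersetCard M univ | x.1 ∉ x.2}
  let bad := pairs.biUnion fun x ↦ Fintype.piFinset fun _ : Fin n ↦ (separating x)ᶜ
  have hpairs : (#pairs : ℝ) ≤ (T : ℝ) ^ (M + 1) := by
    have : #pairs ≤ T ^ (M + 1) :=
      calc #pairs ≤ #((univ : Finset (Fin T)) ×ˢ powersetCard M (univ : Finset (Fin T))) :=
            card_filter_le _ _
        _ = T * T.choose M := by simp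
        _ ≤ T * T ^ M := by gcongr; exact Nat.choose_le_pow T M
        _ = T ^ (M + 1) := by ring
    exact_mod_cast this
  set q : ℝ := (M : ℝ) ^ M / (M + 1) ^ (M + 1)
  have hcompl : ∀ x ∈ pairs, (#(separating x)ᶜ : ℝ) = (1 - q) * (M + 1) ^ T := by
    intro x hx
    simp only [pairs, mem_filter, mem_product, mem_powersetCard] at hx
    rw [card_compl, Nat.cast_sub (card_le_univ _), card_separating_columns hx.1.2.2 hx.2]
    simp
    ring
  have hbad : (#bad : ℝ) < (((M : ℝ) + 1) ^ T) ^ n :=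
    calc (#bad : ℝ)
        ≤ ∑ x ∈ pairs, (#(Fintype.piFinset fun _ : Fin n ↦ (separating x)ᶜ) : ℝ) :=
          mod_cast card_biUnion_le
      _ = ∑ x ∈ pairs, ((1 - q) * (M + 1) ^ T) ^ n := by
          refine sum_congr rfl fun x hx ↦ ?_
          rw [Fintype.card_piFinset, prod_const, Nat.cast_pow, hcompl x hx, card_univ,
            Fintype.card_fin]
      _ = #pairs * (1 - q) ^ n * (((M : ℝ) + 1) ^ T) ^ n := by
          rw [sum_const, nsmul_eq_mul, mul_pow, mul_assoc]
      _ ≤ (T : ℝ) ^ (M + 1) * (1 - q) ^ n * (((M : ℝ) + 1) ^ T) ^ n := by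
          have : 0 ≤ 1 - q := sub_nonneg.2 (pow_div_succ_pow_succ_le_one M)
          gcongr
      _ < 1 * (((M : ℝ) + 1) ^ T) ^ n := by gcongr
      _ = _ := one_mul _
  obtain ⟨A, hA⟩ : ∃ A, A ∉ bad := by
    by_contra! hall
    have huniv : bad = univ := eq_univ_iff_forall.2 hall
    rw [huniv] at hbad
    simp at hbad
  refine ⟨fun j ℓ ↦ decide (A ℓ j = 0), fun S hS i hi hcover ↦ hA ?_⟩
  obtain ⟨U, hSU, hUi, hU⟩ := exists_subsuperset_card_eq (n := M)
    (subset_erase.2 ⟨subset_univ S, hi⟩) hS (by simp; omega)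
  have hiU : i ∉ U := fun h ↦ by simpa using hUi h
  simp only [bad, mem_biUnion, Fintype.mem_piFinset, mem_compl]
  refine ⟨(i, U), by simp [pairs, mem_powersetCard, hU, hiU], fun ℓ hℓ ↦ ?_⟩
  simp only [separating, mem_filter, mem_univ, true_and] at hℓ
  obtain ⟨j, hj, hj0⟩ := hcover ℓ (by simpa using hℓ.1)
  exact hℓ.2 j (hSU hj) (by simpa using hj0)

lemma inv_exp_one_mul_le_pow_div_pow {M : ℕ} (hM : 1 ≤ M) :
    1 / (Real.exp 1 * ((M : ℝ) + 1)) ≤ (M : ℝ) ^ M / (M + 1) ^ (M + 1) := by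
  have hM0 : (0 : ℝ) < M := by exact_mod_cast hM
  have hexp : ((M : ℝ) + 1) ^ M ≤ Real.exp 1 * (M : ℝ) ^ M :=
    calc ((M : ℝ) + 1) ^ M = (1 / (M : ℝ) + 1) ^ M * (M : ℝ) ^ M := by
          rw [← mul_pow]
          field_simp
          ring
      _ ≤ Real.exp (1 / M) ^ M * (M : ℝ) ^ M := by
          gcongr
          exact Real.add_one_le_exp _
      _ = Real.exp 1 * (M : ℝ) ^ M := by
          rw [← Real.exp_nat_mul, mul_one_div_cancel hM0.ne']
  rw [div_le_div_iff₀ (by positivity) (by positivity), pow_succ]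
  nlinarith

/-- Theorem 1 (Dyachkov–Rykov): for fixed `M ≥ 1` and `T → ∞`, code length
`n = ⌈(1+δ)·e·ln 2·(M+1)²·log₂ T⌉` suffices for a Zero False Drop code of order `M` with
`T` codewords, i.e. `n_syn(T,M) ≲ e·ln 2·(M+1)²·log₂ T`. -/
theorem zfd_code_exists_asymptotic (M : ℕ) (hM : 1 ≤ M) (δ : ℝ) (hδ : 0 < δ) :
    ∃ T₀ : ℕ, ∀ T : ℕ, T₀ ≤ T →
      ∃ C : Fin T →
          Fin ⌈(1 + δ) * Real.exp 1 * Real.log 2 * ((M : ℝ) + 1) ^ 2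
                * Real.logb 2 T⌉₊ → Bool,
        IsZFD M C := by
  refine ⟨M + 1, fun T hT ↦ exists_isZFD_of_union_bound hT ?_⟩
  set n := ⌈(1 + δ) * Real.exp 1 * Real.log 2 * ((M : ℝ) + 1) ^ 2 * Real.logb 2 T⌉₊
  set q : ℝ := (M : ℝ) ^ M / (M + 1) ^ (M + 1)
  have hT1 : (1 : ℝ) < T := by exact_mod_cast (by omega : 1 < T)
  have hlog : 0 < Real.log T := Real.log_pos hT1
  have hn : (1 + δ) * Real.exp 1 * ((M : ℝ) + 1) ^ 2 * Real.log T ≤ n := by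
    refine le_trans (le_of_eq ?_) (Nat.le_ceil _)
    have : Real.log 2 ≠ 0 := (Real.log_pos one_lt_two).ne'
    rw [Real.logb]
    field_simp
  have hqn : (1 + δ) * (M + 1) * Real.log T ≤ n * q :=
    calc (1 + δ) * (M + 1) * Real.log T
        = (1 + δ) * Real.exp 1 * ((M : ℝ) + 1) ^ 2 * Real.log T
            * (1 / (Real.exp 1 * ((M : ℝ) + 1))) := by field_simp
      _ ≤ n * q := by
          gcongr
          exact inv_exp_one_mul_le_pow_div_pow hM
  have hq1 : 0 ≤ 1 - q := sub_nonneg.2 (pow_div_succ_pow_succ_le_one M)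
  calc (T : ℝ) ^ (M + 1) * (1 - q) ^ n
      ≤ Real.exp (Real.log T) ^ (M + 1) * Real.exp (-q) ^ n := by
        rw [Real.exp_log (by linarith)]
        gcongr
        exact Real.one_sub_le_exp_neg q
    _ = Real.exp ((M + 1) * Real.log T - n * q) := by
        rw [← Real.exp_nat_mul, ← Real.exp_nat_mul, ← Real.exp_add]
        push_cast
        ring_nf
    _ < 1 := by
        rw [Real.exp_lt_one_iff]
        have : 0 < δ * (M + 1) * Real.log T := by positivity
        linarith
end

section
/- Let T, M, n be positive integers with M < T, and suppose there exists p ∈ [0,1] such that (T choose M)·(T−M)·(1 − p(1−p)^M)^n < 1. Then there exists a binary code C : Fin T → (Fin n → Bool) that is Zero False Drop of order M: for every subset S ⊆ Fin T with |S| ≤ M and every i ∉ S, the codeword C i is not covered by the componentwise Boolean OR of {C j : j ∈ S}. -/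
/-- The mass that a Bernoulli distribution with parameter `p` gives to a bit. -/
def bernoulliMass (p : ℝ) (b : Bool) : ℝ := if b then p else 1 - p

/-- The Bernoulli mass of the bit of user `k`, restricted to the event that user `i` sends
`true` and all users in `S` send `false`. -/
def privateBitMass {ι : Type*} [DecidableEq ι] (p : ℝ) (S : Finset ι) (i k : ι) (b : Bool) : ℝ :=
  if k = i then (if b then p else 0) else if k ∈ S then (if b then 0 else 1 - p)
    else bernoulliMass p b

section ColumnMass

variable {ι : Type*} [DecidableEq ι] {p : ℝ} {S : Finset ι} {i : ι}

theorem bernoulliMass_nonneg (h0 : 0 ≤ p) (h1 : p ≤ 1) (b : Bool) : 0 ≤ bernoulliMass p b := by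
  unfold bernoulliMass
  split_ifs <;> linarith

theorem privateBitMass_nonneg (h0 : 0 ≤ p) (h1 : p ≤ 1) (k : ι) (b : Bool) :
    0 ≤ privateBitMass p S i k b := by
  unfold privateBitMass bernoulliMass
  split_ifs <;> linarith

theorem privateBitMass_le (h0 : 0 ≤ p) (h1 : p ≤ 1) (k : ι) (b : Bool) :
    privateBitMass p S i k b ≤ bernoulliMass p b := by
  unfold privateBitMass bernoulliMass
  split_ifs <;> linarith

variable [Fintype ι]

theorem sum_prod_bernoulliMass (p : ℝ) :
    ∑ c : ι → Bool, ∏ k, bernoulliMass p (c k) = 1 := by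
  rw [← Fintype.prod_sum (fun _ : ι => bernoulliMass p)]
  simp [bernoulliMass]

theorem sum_prod_privateBitMass (p : ℝ) (hi : i ∉ S) :
    ∑ c : ι → Bool, ∏ k, privateBitMass p S i k (c k) = p * (1 - p) ^ S.card := by
  rw [← Fintype.prod_sum (privateBitMass p S i)]
  have hsum (k : ι) : ∑ b, privateBitMass p S i k b =
      (if k = i then p else 1) * (if k ∈ S then 1 - p else 1) := by
    by_cases hk : k = i
    · subst hk
      simp [privateBitMass, hi]
    · by_cases hS : k ∈ S <;> simp [privateBitMass, bernoulliMass, hk, hS]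
  simp only [hsum, Finset.prod_mul_distrib]
  simp [Finset.prod_ite_mem]

/-- A column in which user `i` is covered by the users in `S` has no restricted mass. -/
theorem prod_privateBitMass_eq_zero {c : ι → Bool} (hi : i ∉ S)
    (hc : c i = true → ∃ j ∈ S, c j = true) : ∏ k, privateBitMass p S i k (c k) = 0 := by
  by_cases h : c i = true
  · obtain ⟨j, hj, hcj⟩ := hc h
    have hji : j ≠ i := fun h => hi (h ▸ hj)
    exact Finset.prod_eq_zero (Finset.mem_univ j) (by simp [privateBitMass, hji, hj, hcj])
  · exact Finset.prod_eq_zero (Finset.mem_univ i) (by simp [privateBitMass, h])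

end ColumnMass

/-- A code that is not Zero False Drop of order `M < T` has a codeword covered by the
sum of exactly `M` others. -/
theorem exists_covered_of_not_isZFD {T n M : ℕ} (hMT : M < T) {C : Fin T → Fin n → Bool}
    (hC : ¬ IsZFD M C) : ∃ S : Finset (Fin T), S.card = M ∧ ∃ i ∉ S,
      ∀ ℓ, C i ℓ = true → ∃ j ∈ S, C j ℓ = true := by
  unfold IsZFD at hC
  push Not at hC
  obtain ⟨S, hS, i, hi, hcov⟩ := hC
  have hsub : S ⊆ Finset.univ.erase i := fun j hj =>
    Finset.mem_erase.2 ⟨fun h => hi (h ▸ hj), Finset.mem_univ j⟩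
  obtain ⟨U, hSU, hU, hcard⟩ := Finset.exists_subsuperset_card_eq hsub hS
    (by simp; omega)
  refine ⟨U, hcard, i, fun h => by simpa using hU h, fun ℓ hℓ => ?_⟩
  obtain ⟨j, hj, hjℓ⟩ := hcov ℓ hℓ
  exact ⟨j, hSU hj, hjℓ⟩

/-- Non-asymptotic existence statement from the random-coding proof of Theorem 1: if for
some `p ∈ [0,1]` one has `(T choose M)·(T−M)·(1 − p(1−p)^M)^n < 1`, then a Zero False Drop
code of order `M` with `T` codewords of length `n` exists. -/
theorem zfd_code_exists (T M n : ℕ) (hT : 0 < T) (hM : 0 < M) (hn : 0 < n) (hMT : M < T)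
    (hp : ∃ p : ℝ, 0 ≤ p ∧ p ≤ 1 ∧
      (T.choose M : ℝ) * ((T : ℝ) - (M : ℝ)) * (1 - p * (1 - p) ^ M) ^ n < 1) :
    ∃ C : Fin T → Fin n → Bool, IsZFD M C := by
  obtain ⟨p, h0, h1, hlt⟩ := hp
  by_contra! hbad
  let v (c : Fin T → Bool) : ℝ := ∏ k, bernoulliMass p (c k)
  let u (S : Finset (Fin T)) (i : Fin T) (c : Fin T → Bool) : ℝ :=
    ∏ k, privateBitMass p S i k (c k)
  have huv (S i c) : 0 ≤ v c - u S i c := sub_nonneg.2 <|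
    Finset.prod_le_prod (fun k _ => privateBitMass_nonneg h0 h1 k _)
      (fun k _ => privateBitMass_le h0 h1 k _)
  let I := (Finset.powersetCard M (Finset.univ : Finset (Fin T))).sigma (fun S => Sᶜ)
  have hcover (D : Fin n → Fin T → Bool) :
      ∏ ℓ, v (D ℓ) ≤ ∑ x ∈ I, ∏ ℓ, (v (D ℓ) - u x.1 x.2 (D ℓ)) := by
    obtain ⟨S, hS, i, hi, hcov⟩ := exists_covered_of_not_isZFD hMT (hbad fun i ℓ => D ℓ i)
    have hu (ℓ) : u S i (D ℓ) = 0 := prod_privateBitMass_eq_zero hi (hcov ℓ)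
    have hmem : (⟨S, i⟩ : Σ _ : Finset (Fin T), Fin T) ∈ I := by simp [I, hS, hi]
    calc ∏ ℓ, v (D ℓ) = ∏ ℓ, (v (D ℓ) - u S i (D ℓ)) := by simp [hu]
      _ ≤ _ := Finset.single_le_sum
        (f := fun x : Σ _ : Finset (Fin T), Fin T => ∏ ℓ, (v (D ℓ) - u x.1 x.2 (D ℓ)))
        (a := ⟨S, i⟩) (fun x _ => Finset.prod_nonneg fun ℓ _ => huv _ _ _) hmem
  have hterm : ∀ x ∈ I, ∑ D : Fin n → Fin T → Bool, ∏ ℓ, (v (D ℓ) - u x.1 x.2 (D ℓ)) =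
      (1 - p * (1 - p) ^ M) ^ n := by
    rintro ⟨S, i⟩ hx
    obtain ⟨hS, hi⟩ : S.card = M ∧ i ∉ S := by simpa [I] using hx
    rw [← Fintype.sum_pow (fun c => v c - u S i c), Finset.sum_sub_distrib,
      sum_prod_bernoulliMass, sum_prod_privateBitMass p hi, hS]
  have hcard : (I.card : ℝ) = T.choose M * ((T : ℝ) - M) := by
    have : I.card = T.choose M * (T - M) := by
      rw [Finset.card_sigma, Finset.sum_congr rfl (g := fun _ => T - M)]
      · simp
      · intro S hS
        rw [Finset.card_compl, (Finset.mem_powersetCard.1 hS).2, Fintype.card_fin]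
    rw [this, Nat.cast_mul, Nat.cast_sub hMT.le]
  refine hlt.not_ge ?_
  calc (1 : ℝ) = ∑ D : Fin n → Fin T → Bool, ∏ ℓ, v (D ℓ) := by
        rw [← Fintype.sum_pow v, sum_prod_bernoulliMass, one_pow]
    _ ≤ ∑ D : Fin n → Fin T → Bool, ∑ x ∈ I, ∏ ℓ, (v (D ℓ) - u x.1 x.2 (D ℓ)) :=
        Finset.sum_le_sum fun D _ => hcover D
    _ = _ := by
        rw [Finset.sum_comm, Finset.sum_congr rfl hterm, Finset.sum_const, nsmul_eq_mul, hcard]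
end

section
/- Let M ≥ 1 be an integer and p ∈ [0,1]. Define real sequences (a_i¹) and (a_i⁰) by a₁¹ = 1 − (1−p)^M, a₁⁰ = 1, and for i ≥ 2: a_i¹ = p·a_{i−1}¹ + (1−p)·(1 − (1−p)^{M−1})·a_{i−1}⁰ and a_i⁰ = p·a_{i−1}¹ + (1−p)·a_{i−1}⁰. Then for every integer k ≥ 1, p·a_k¹ + (1−p)·a_k⁰ ≤ (1 − p(1−p)^M)^k. -/
/-- The recursively defined covering probability `f_k = p·a_k¹ + (1−p)·a_k⁰` of a class of
`k` positions satisfies `f_k ≤ (1 − p(1−p)^M)^k` for every `k ≥ 1`. -/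
theorem recursive_covering_probability_bound (M : ℕ) (hM : 1 ≤ M) (p : ℝ)
    (hp0 : 0 ≤ p) (hp1 : p ≤ 1) (a1 a0 : ℕ → ℝ)
    (ha1_init : a1 1 = 1 - (1 - p) ^ M) (ha0_init : a0 1 = 1)
    (ha1_rec : ∀ i : ℕ, 2 ≤ i →
      a1 i = p * a1 (i - 1) + (1 - p) * (1 - (1 - p) ^ (M - 1)) * a0 (i - 1))
    (ha0_rec : ∀ i : ℕ, 2 ≤ i → a0 i = p * a1 (i - 1) + (1 - p) * a0 (i - 1)) :
    ∀ k : ℕ, 1 ≤ k → p * a1 k + (1 - p) * a0 k ≤ (1 - p * (1 - p) ^ M) ^ k := by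
  obtain ⟨m, rfl⟩ : ∃ m, M = m + 1 := ⟨M - 1, by omega⟩
  have hq0 : 0 ≤ 1 - p := by linarith
  have hs0 : 0 ≤ (1 - p) ^ m := pow_nonneg hq0 m
  have hs1 : (1 - p) ^ m ≤ 1 := pow_le_one₀ hq0 (by linarith)
  simp only [Nat.add_sub_cancel, pow_succ] at ha1_init ha1_rec ⊢
  generalize (1 - p) ^ m = s at *
  obtain ⟨c, hc⟩ : ∃ c, c = p * (s * (1 - p)) := ⟨_, rfl⟩
  have hc0 : 0 ≤ c := hc ▸ mul_nonneg hp0 (mul_nonneg hs0 hq0)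
  have hc4 : c ≤ 1 / 4 := by
    have hle : p * (1 - p) * s ≤ p * (1 - p) :=
      mul_le_of_le_one_right (mul_nonneg hp0 hq0) hs1
    nlinarith [sq_nonneg (p - 1 / 2)]
  rw [← hc]
  suffices h : ∀ k : ℕ, 1 ≤ k → 0 ≤ a0 k ∧ a0 k / 2 ≤ p * a1 k + (1 - p) * a0 k ∧
      p * a1 k + (1 - p) * a0 k ≤ a0 k ∧ p * a1 k + (1 - p) * a0 k ≤ (1 - c) ^ k from
    fun k hk => (h k hk).2.2.2
  intro k hk
  induction k, hk using Nat.le_induction with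
  | base =>
    have hf : p * a1 1 + (1 - p) * a0 1 = 1 - c := by rw [ha1_init, ha0_init, hc]; ring
    rw [hf, ha0_init, pow_one]
    refine ⟨?_, ?_, ?_, ?_⟩ <;> linarith
  | succ k hk ih =>
    obtain ⟨h0, hhalf, hle, hpow⟩ := ih
    have hx := ha1_rec (k + 1) (by omega)
    have hy := ha0_rec (k + 1) (by omega)
    rw [Nat.add_sub_cancel] at hx hy
    have hf : p * a1 (k + 1) + (1 - p) * a0 (k + 1) =
        p * a1 k + (1 - p) * a0 k - c * a0 k := by
      rw [hx, hy, hc]; ring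
    rw [hf, hy]
    generalize p * a1 k + (1 - p) * a0 k = f at *
    have hca : 0 ≤ c * a0 k := mul_nonneg hc0 h0
    have hca4 : c * a0 k ≤ 1 / 4 * a0 k := mul_le_mul_of_nonneg_right hc4 h0
    refine ⟨by linarith, by linarith, by linarith, ?_⟩
    calc f - c * a0 k ≤ f - c * f := by gcongr
      _ = f * (1 - c) := by ring
      _ ≤ (1 - c) ^ k * (1 - c) := mul_le_mul_of_nonneg_right hpow (by linarith)
      _ = (1 - c) ^ (k + 1) := (pow_succ _ _).symm
end

section
/- Let M ≥ 1 be an integer, p ∈ (0,1], set q = p(1−p)^M, and assume 1 − 4q > 0. Define (a_i¹), (a_i⁰) by a₁¹ = 1 − (1−p)^M, a₁⁰ = 1, a_i¹ = p·a_{i−1}¹ + (1−p)(1 − (1−p)^{M−1})·a_{i−1}⁰, a_i⁰ = p·a_{i−1}¹ + (1−p)·a_{i−1}⁰, and f_k = p·a_k¹ + (1−p)·a_k⁰. Then for every integer k ≥ 2: f_k = ((1+√(1−4q))/2)^{k−2} · ( ( (1/2 − 2q + q²)/√(1−4q) ) + 1/2 − q ) − ((1−√(1−4q))/2)^{k−2}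 · ( ( (1/2 − 2q + q²)/√(1−4q) ) − 1/2 + q ). -/
/-- A solution of `u (n + 2) = u (n + 1) - q * u n` is determined, through the roots
`(1 ± s) / 2` of the characteristic polynomial `X ^ 2 - X + q`, by its first two values. -/
theorem eq_of_two_term_recurrence {u : ℕ → ℝ} {q s c d : ℝ} (hs : s ≠ 0)
    (hs2 : s ^ 2 = 1 - 4 * q) (h0 : u 0 = 2 * d) (h1 : u 1 = c + d)
    (hrec : ∀ n, u (n + 2) = u (n + 1) - q * u n) (n : ℕ) :
    u n = ((1 + s) / 2) ^ n * (c / s + d) - ((1 - s) / 2) ^ n * (c / s - d) := by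
  have hq : q = (1 - s ^ 2) / 4 := by linarith
  induction n using Nat.twoStepInduction with
  | zero => rw [h0]; ring
  | one => rw [h1]; field_simp; ring
  | more n ih0 ih1 => rw [hrec, ih0, ih1, hq]; ring


/-- Closed form of the covering probability `f_k = p·a_k¹ + (1−p)·a_k⁰` obtained by
diagonalizing the transition matrix: for `k ≥ 2`, with `q = p(1−p)^M` and `1 − 4q > 0`,
`f_k = ((1+√(1−4q))/2)^{k−2}·((1/2−2q+q²)/√(1−4q) + 1/2 − q)
     − ((1−√(1−4q))/2)^{k−2}·((1/2−2q+q²)/√(1−4q) − 1/2 + q)`. -/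
theorem covering_probability_closed_form (M : ℕ) (hM : 1 ≤ M) (p : ℝ)
    (hp0 : 0 < p) (hp1 : p ≤ 1) (q : ℝ) (hq : q = p * (1 - p) ^ M) (hq4 : 0 < 1 - 4 * q)
    (a1 a0 : ℕ → ℝ)
    (ha1_init : a1 1 = 1 - (1 - p) ^ M) (ha0_init : a0 1 = 1)
    (ha1_rec : ∀ i : ℕ, 2 ≤ i →
      a1 i = p * a1 (i - 1) + (1 - p) * (1 - (1 - p) ^ (M - 1)) * a0 (i - 1))
    (ha0_rec : ∀ i : ℕ, 2 ≤ i → a0 i = p * a1 (i - 1) + (1 - p) * a0 (i - 1))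
    (f : ℕ → ℝ) (hf : ∀ k, f k = p * a1 k + (1 - p) * a0 k) :
    ∀ k : ℕ, 2 ≤ k →
      f k = ((1 + Real.sqrt (1 - 4 * q)) / 2) ^ (k - 2)
              * ((1 / 2 - 2 * q + q ^ 2) / Real.sqrt (1 - 4 * q) + 1 / 2 - q)
            - ((1 - Real.sqrt (1 - 4 * q)) / 2) ^ (k - 2)
              * ((1 / 2 - 2 * q + q ^ 2) / Real.sqrt (1 - 4 * q) - 1 / 2 + q) := by
  obtain ⟨m, rfl⟩ : ∃ m, M = m + 1 := ⟨M - 1, by omega⟩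
  have h1 (i : ℕ) : a1 (i + 2) =
      p * a1 (i + 1) + (1 - p) * (1 - (1 - p) ^ m) * a0 (i + 1) := ha1_rec (i + 2) (by omega)
  have h0 (i : ℕ) : a0 (i + 2) = p * a1 (i + 1) + (1 - p) * a0 (i + 1) :=
    ha0_rec (i + 2) (by omega)
  have hrec (i : ℕ) : f (i + 3) = f (i + 2) - q * f (i + 1) := by
    simp only [hf, h1, h0, hq]
    ring
  have hf2 : f 2 = 1 - 2 * q := by
    rw [hf, h1 0, h0 0, zero_add, ha1_init, ha0_init, hq]
    ring
  have hf3 : f 3 = 1 - 3 * q + q ^ 2 := by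
    rw [hrec 0, hf2, hf, zero_add, ha1_init, ha0_init, hq]
    ring
  intro k hk
  obtain ⟨n, rfl⟩ := Nat.exists_eq_add_of_le' hk
  have key := eq_of_two_term_recurrence (u := fun n => f (n + 2))
    (c := 1 / 2 - 2 * q + q ^ 2) (d := 1 / 2 - q) (Real.sqrt_pos.mpr hq4).ne'
    (Real.sq_sqrt hq4.le) (by simp only [zero_add, hf2]; ring)
    (by simp only [Nat.reduceAdd, hf3]; ring) (fun n => hrec (n + 1)) n
  simp only [Nat.add_sub_cancel]
  rw [key]
  ring
end

section
/- For every real q with 0 ≤ q ≤ 0.228 and q < 1/4, (1/2 − 2q + q²)/√(1 − 4q) + 1/2 − q ≤ (1 − q)². -/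
/-- Inequality (eq. 5) of the paper: for `0 ≤ q ≤ 0.228` with `q < 1/4`,
`(1/2 − 2q + q²)/√(1 − 4q) + 1/2 − q ≤ (1 − q)²`. -/
theorem larger_eigenvalue_coefficient_bound (q : ℝ) (hq0 : 0 ≤ q) (hq228 : q ≤ 0.228)
    (hq : q < 1 / 4) :
    (1 / 2 - 2 * q + q ^ 2) / Real.sqrt (1 - 4 * q) + 1 / 2 - q ≤ (1 - q) ^ 2 := by
  have hs : 0 < Real.sqrt (1 - 4 * q) := Real.sqrt_pos.mpr (by linarith)
  have hsq : Real.sqrt (1 - 4 * q) ^ 2 = 1 - 4 * q := Real.sq_sqrt (by linarith)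
  have hcubic : 0 ≤ 1 - 6 * q + 8 * q ^ 2 - 4 * q ^ 3 := by
    norm_num at hq228
    have hfactor : 0 ≤ (57 / 250 - q) * (4 * (q - 443 / 500) ^ 2 + 1) :=
      mul_nonneg (by linarith) (by positivity)
    nlinarith [hfactor]
  have hfac : 0 ≤ 1 / 2 - q + q ^ 2 := by nlinarith [sq_nonneg q]
  have hnum : 1 / 2 - 2 * q + q ^ 2 ≤ (1 / 2 - q + q ^ 2) * Real.sqrt (1 - 4 * q) := by
    refine le_of_abs_le (abs_le_of_sq_le_sq ?_ (mul_nonneg hfac hs.le))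
    rw [mul_pow, hsq]
    linear_combination mul_nonneg (sq_nonneg q) hcubic
  have hdiv := (div_le_iff₀ hs).mpr hnum
  linear_combination hdiv
end

section
/- For every real p ∈ [0,1] with p ≠ 1/2 and every integer k ≥ 1, ((1−p)^{k+2} − p^{k+2})/(1 − 2p) ≤ (1 − p(1−p))^k. -/
theorem div_sub_pow_sub_pow_nonneg {x y : ℝ} (hx : 0 ≤ x) (hy : 0 ≤ y) (n : ℕ) :
    0 ≤ (x ^ n - y ^ n) / (x - y) := by
  rcases eq_or_ne x y with rfl | hxy
  · simp
  · rw [← geom_sum₂_mul, mul_div_cancel_right₀ _ (sub_ne_zero.mpr hxy)]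
    positivity

/-- Inequality (eq. 6) of the paper: for `p ∈ [0,1]`, `p ≠ 1/2` and `k ≥ 1`,
`((1−p)^{k+2} − p^{k+2})/(1 − 2p) ≤ (1 − p(1−p))^k`. -/
theorem covering_probability_M_eq_one_bound (p : ℝ) (hp0 : 0 ≤ p) (hp1 : p ≤ 1)
    (hp : p ≠ 1 / 2) (k : ℕ) (hk : 1 ≤ k) :
    ((1 - p) ^ (k + 2) - p ^ (k + 2)) / (1 - 2 * p) ≤ (1 - p * (1 - p)) ^ k := by
  have hne : 1 - 2 * p ≠ 0 := fun h => hp (by linarith)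
  clear hk
  induction k with
  | zero =>
    rw [div_eq_of_eq_mul hne (show _ = 1 * (1 - 2 * p) by ring), pow_zero]
  | succ k ih =>
    have hS : 0 ≤ ((1 - p) ^ k - p ^ k) / (1 - 2 * p) := by
      have h := div_sub_pow_sub_pow_nonneg (sub_nonneg.mpr hp1) hp0 k
      rwa [show 1 - p - p = 1 - 2 * p by ring] at h
    have hrec : ((1 - p) ^ (k + 1 + 2) - p ^ (k + 1 + 2)) / (1 - 2 * p) =
        ((1 - p) ^ (k + 2) - p ^ (k + 2)) / (1 - 2 * p) * (1 - p * (1 - p)) -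
          (p * (1 - p)) ^ 2 * (((1 - p) ^ k - p ^ k) / (1 - 2 * p)) := by
      field_simp
      ring
    have hfac : 0 ≤ 1 - p * (1 - p) := by nlinarith
    rw [hrec, pow_succ]
    exact (sub_le_self _ (mul_nonneg (sq_nonneg _) hS)).trans
      (mul_le_mul_of_nonneg_right ih hfac)
end
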